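/- arXiv:0712.4046 — 9 statements merged into one kernel-verified Lean document; each statement's English description precedes it below -/
import Mathlib

section
/- Let R be a commutative ring, N a positive integer, m ≥ 0, and let h ∈ (R[X])[Y] have Y-degree at most m, with every coefficient h_i ∈ R[X] of degree strictly less than 2N. Then for every j with N ≤ j ≤ 2N − 2, the coefficient of X^(mN + j) in the reversed sum Σ_{i=0}^{m} h_{m−i}(X)·X^(iN) equals the coefficient of X^j in h_0. That is, the highest N − 1 terms of the normalized reciprocal evaluation X^(Nm)·h(X, X^(−N)) are precisely the highest N − 1 terms of h_0. -/
open Polynomial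

/-- Reciprocal Kronecker substitution: the highest N - 1 terms of the
normalized reciprocal evaluation are the highest N - 1 terms of h_0. -/
theorem kronecker_reciprocal_high {R : Type*} [CommRing R] (N : ℕ) (hN : 0 < N) (m : ℕ)
    (h : Polynomial (Polynomial R)) (hdegY : h.degree ≤ (m : ℕ))
    (hdeg : ∀ i, (h.coeff i).degree < ((2 * N : ℕ) : ℕ)) (j : ℕ) (hjl : N ≤ j)
    (hju : j ≤ 2 * N - 2) :
    (∑ i ∈ Finset.range (m + 1), h.coeff (m - i) * Polynomial.X ^ (i * N)).coeff (m * N + j)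
      = (h.coeff 0).coeff j := by
  rw [Finset.sum_range_succ, coeff_add, Nat.sub_self, Nat.add_comm (m * N) j, coeff_mul_X_pow,
    finsetSum_coeff, Finset.sum_eq_zero, zero_add]
  intro i hi
  have hshift : 2 * N + i * N ≤ j + m * N := by
    have := Nat.mul_le_mul_right N (Nat.succ_le_of_lt (Finset.mem_range.mp hi))
    rw [Nat.succ_mul] at this
    omega
  rw [coeff_mul_X_pow', if_pos (by omega)]
  exact coeff_eq_zero_of_degree_lt
    ((hdeg (m - i)).trans_le (by exact_mod_cast Nat.le_sub_of_add_le hshift))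
end

section
/- Let R be a commutative ring, N a positive integer, m ≥ 0, and let h, h' ∈ (R[X])[Y] each have Y-degree at most m, with every coefficient h_i, h'_i ∈ R[X] of degree strictly less than 2N. If Σ_{i=0}^{m} h_i(X)·X^(iN) = Σ_{i=0}^{m} h'_i(X)·X^(iN) and Σ_{i=0}^{m} h_{m−i}(X)·X^(iN) = Σ_{i=0}^{m} h'_{m−i}(X)·X^(iN), then h = h'. That is, a bivariate polynomial with Y-degree at most m and Y-coefficients of X-degree less than 2N is uniquely determined by its evaluation at Y = X^N together with its normalized reciprocal evaluation at Y = X^(−N). -/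
open Polynomial

/-- A sequence of polynomials of degree less than `2 * N` vanishes up to index `m` as soon as its
evaluation at `X ^ N` and its reciprocal evaluation both vanish. -/
theorem eq_zero_of_kronecker_reciprocal_eq_zero {R : Type*} [CommRing R] (N m : ℕ) (d : ℕ → R[X])
    (hd : ∀ i, (d i).degree < ((2 * N : ℕ) : ℕ))
    (h₁ : ∑ i ∈ Finset.range (m + 1), d i * X ^ (i * N) = 0)
    (h₂ : ∑ i ∈ Finset.range (m + 1), d (m - i) * X ^ (i * N) = 0)
    (i : ℕ) (hi : i ≤ m) : d i = 0 := by
  induction i using Nat.strong_induction_on with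
  | _ i ih =>
  have coeff_large (j n : ℕ) (hn : 2 * N ≤ n) : (d j).coeff n = 0 :=
    coeff_eq_zero_of_degree_lt ((hd j).trans_le (by exact_mod_cast hn))
  ext n
  rw [coeff_zero]
  rcases lt_or_ge n N with hn | hn
  · have key := congrArg (fun p => p.coeff (n + i * N)) h₁
    simp only [finsetSum_coeff, coeff_zero] at key
    rw [Finset.sum_eq_single_of_mem i (Finset.mem_range.2 (by omega)), coeff_mul_X_pow] at key
    · exact key
    · intro j _ hji
      rcases lt_or_gt_of_ne hji with hlt | hgt
      · rw [ih j hlt (by omega), zero_mul, coeff_zero]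
      · have hmul : (i + 1) * N ≤ j * N := Nat.mul_le_mul_right N hgt
        rw [coeff_mul_X_pow', if_neg (by linarith)]
  · have key := congrArg (fun p => p.coeff (n + (m - i) * N)) h₂
    simp only [finsetSum_coeff, coeff_zero] at key
    rw [Finset.sum_eq_single_of_mem (m - i) (Finset.mem_range.2 (by omega)), coeff_mul_X_pow,
      Nat.sub_sub_self hi] at key
    · exact key
    · intro j hj hji
      rw [Finset.mem_range] at hj
      rcases lt_or_gt_of_ne hji with hlt | hgt
      · have hmul : (j + 1) * N ≤ (m - i) * N := Nat.mul_le_mul_right N hlt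
        rw [add_one_mul] at hmul
        rw [coeff_mul_X_pow', if_pos (by omega), coeff_large _ _ (by omega)]
      · rw [ih (m - j) (by omega) (by omega), zero_mul, coeff_zero]

/-- Correctness of the reciprocal Kronecker substitution: a bivariate polynomial
with Y-degree at most m and Y-coefficients of X-degree less than 2N is determined
by its evaluation at Y = X^N together with its normalized reciprocal evaluation. -/
theorem kronecker_reciprocal_injective {R : Type*} [CommRing R] (N : ℕ) (hN : 0 < N) (m : ℕ)
    (h h' : Polynomial (Polynomial R))
    (hdegY : h.degree ≤ (m : ℕ)) (hdegY' : h'.degree ≤ (m : ℕ))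
    (hdeg : ∀ i, (h.coeff i).degree < ((2 * N : ℕ) : ℕ))
    (hdeg' : ∀ i, (h'.coeff i).degree < ((2 * N : ℕ) : ℕ))
    (heq1 : ∑ i ∈ Finset.range (m + 1), h.coeff i * Polynomial.X ^ (i * N)
          = ∑ i ∈ Finset.range (m + 1), h'.coeff i * Polynomial.X ^ (i * N))
    (heq2 : ∑ i ∈ Finset.range (m + 1), h.coeff (m - i) * Polynomial.X ^ (i * N)
          = ∑ i ∈ Finset.range (m + 1), h'.coeff (m - i) * Polynomial.X ^ (i * N)) :
    h = h' := by
  ext1 i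
  rcases le_or_gt i m with hi | hi
  · refine sub_eq_zero.1 (eq_zero_of_kronecker_reciprocal_eq_zero N m
      (fun j => h.coeff j - h'.coeff j)
      (fun j => (degree_sub_le _ _).trans_lt (max_lt (hdeg j) (hdeg' j))) ?_ ?_ i hi)
    · simp only [sub_mul, Finset.sum_sub_distrib, heq1, sub_self]
    · simp only [sub_mul, Finset.sum_sub_distrib, heq2, sub_self]
  · have hmi : ((m : ℕ) : WithBot ℕ) < i := by exact_mod_cast hi
    rw [coeff_eq_zero_of_degree_lt (hdegY.trans_lt hmi),
      coeff_eq_zero_of_degree_lt (hdegY'.trans_lt hmi)]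
end

section
/- Let R be a commutative ring in which the map r ↦ 2r is injective, and let N be a positive integer. If h, h' ∈ (R[X])[Y] have all their coefficients h_i, h'_i ∈ R[X] of degree strictly less than 2N, and if h(X, X^N) = h'(X, X^N) and h(X, −X^N) = h'(X, −X^N) in R[X], then h = h'. That is, such a bivariate polynomial is uniquely determined by its evaluations at Y = X^N and Y = −X^N. -/
open Polynomial

/-- A bivariate polynomial with coefficients of degree less than `2 * N` that vanishes at
`Y = X ^ N` and at `Y = -X ^ N` has no constant term. -/
lemma coeff_zero_eq_zero_of_eval_X_pow {R : Type*} [CommRing R]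
    (hinj : Function.Injective (fun r : R => 2 * r)) {N : ℕ} {d : R[X][X]}
    (hdeg : (d.coeff 0).degree < (2 * N : ℕ))
    (hpos : d.eval (X ^ N) = 0) (hneg : d.eval (-X ^ N) = 0) : d.coeff 0 = 0 := by
  have hd : d.divX.divX * X ^ 2 + C (d.coeff 1) * X + C (d.coeff 0) = d := by
    conv_rhs => rw [← divX_mul_X_add d, ← divX_mul_X_add d.divX, coeff_divX]
    ring
  generalize d.divX.divX = q at hd
  have key : 2 * d.coeff 0 = X ^ (2 * N) * -(q.eval (X ^ N) + q.eval (-X ^ N)) := by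
    rw [← hd] at hpos hneg
    simp only [eval_add, eval_mul, eval_pow, eval_X, eval_C] at hpos hneg
    linear_combination hpos + hneg
  ext r
  rcases lt_or_ge r (2 * N) with hr | hr
  · apply hinj
    have := congrArg (fun p => p.coeff r) key
    simpa [coeff_X_pow_mul', hr.not_ge, coeff_ofNat_mul] using this
  · exact coeff_eq_zero_of_degree_lt (hdeg.trans_le (by exact_mod_cast hr))

/-- A bivariate polynomial with coefficients of degree less than `2 * N` that vanishes at
`Y = X ^ N` and at `Y = -X ^ N` is zero. -/
lemma eq_zero_of_eval_X_pow {R : Type*} [CommRing R]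
    (hinj : Function.Injective (fun r : R => 2 * r)) {N : ℕ} {d : R[X][X]}
    (hdeg : ∀ i, (d.coeff i).degree < (2 * N : ℕ))
    (hpos : d.eval (X ^ N) = 0) (hneg : d.eval (-X ^ N) = 0) : d = 0 := by
  ext1 n
  rw [coeff_zero]
  induction n generalizing d with
  | zero => exact coeff_zero_eq_zero_of_eval_X_pow hinj (hdeg 0) hpos hneg
  | succ n ih =>
    have h0 := coeff_zero_eq_zero_of_eval_X_pow hinj (hdeg 0) hpos hneg
    have hd : d.divX * X = d := by simpa [h0] using divX_mul_X_add d
    have hreg : IsRightRegular (X ^ N : R[X]) := (monic_X_pow N).isRegular.right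
    rw [← coeff_divX]
    refine ih (fun i => by simpa only [coeff_divX] using hdeg (i + 1)) (hreg ?_) (hreg ?_)
    · rw [← hd, eval_mul, eval_X] at hpos
      simpa using hpos
    · rw [← hd, eval_mul, eval_X] at hneg
      simpa using hneg

/-- Correctness of the negated Kronecker substitution. -/
theorem kronecker_negated_injective {R : Type*} [CommRing R]
    (hinj : Function.Injective (fun r : R => 2 * r)) (N : ℕ) (hN : 0 < N)
    (h h' : Polynomial (Polynomial R))
    (hdeg : ∀ i, (h.coeff i).degree < ((2 * N : ℕ) : ℕ))
    (hdeg' : ∀ i, (h'.coeff i).degree < ((2 * N : ℕ) : ℕ))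
    (heq1 : Polynomial.eval (Polynomial.X ^ N) h = Polynomial.eval (Polynomial.X ^ N) h')
    (heq2 : Polynomial.eval (-(Polynomial.X ^ N)) h
          = Polynomial.eval (-(Polynomial.X ^ N)) h') :
    h = h' := by
  refine sub_eq_zero.mp (eq_zero_of_eval_X_pow hinj (N := N) (fun i => ?_) ?_ ?_)
  · rw [coeff_sub]
    exact (degree_sub_le _ _).trans_lt (max_lt (hdeg i) (hdeg' i))
  · rw [eval_sub, heq1, sub_self]
  · rw [eval_sub, heq2, sub_self]
end

section
/- Let R be a commutative ring in which the map r ↦ 2r is injective, let N be a positive integer and m ≥ 0. Let h, h' ∈ (R[X])[Y] each have Y-degree at most m, with every coefficient h_i, h'_i ∈ R[X] of degree strictly less than 4N. Suppose the following four equalities hold in R[X]: Σ_{i=0}^{m} h_i X^(iN) = Σ_{i=0}^{m} h'_i X^(iN); Σ_{i=0}^{m} (−1)^i h_i X^(iN) = Σ_{i=0}^{m} (−1)^i h'_i X^(iN); Σ_{i=0}^{m} h_{m−i} X^(iN) = Σ_{i=0}^{m} h'_{m−i} X^(iN); and Σ_{i=0}^{m} (−1)^i h_{m−i} X^(iN)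 = Σ_{i=0}^{m} (−1)^i h'_{m−i} X^(iN). Then h = h'. That is, h is uniquely determined by its evaluations at the four points Y = X^N, −X^N, X^(−N), −X^(−N) (the reciprocal evaluations being normalized by the factor X^(Nm)). -/
open Polynomial

section TwoPoint

variable {R : Type*} [CommRing R]

/-- The evaluations at `X ^ N` and `-X ^ N`, combined into one relation among the coefficients
`d j` for `j` of the same parity as `p`. -/
lemma sum_parity_coeff_eq_zero {N m : ℕ} {d : ℕ → R[X]}
    (hpos : ∑ i ∈ Finset.range (m + 1), d i * X ^ (i * N) = 0)
    (hneg : ∑ i ∈ Finset.range (m + 1), (-1 : R[X]) ^ i * d i * X ^ (i * N) = 0) (p n : ℕ) :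
    ∑ j ∈ Finset.range (m + 1),
      (if Even (p + j) then 2 * (if j * N ≤ n then (d j).coeff (n - j * N) else 0) else 0) = 0 := by
  have hsum : ∑ j ∈ Finset.range (m + 1),
      (if Even (p + j) then 2 * (d j * X ^ (j * N)) else 0) = 0 := by
    have hcomb := congrArg₂ (fun a b : R[X] => a + (-1) ^ p * b) hpos hneg
    simp only [mul_zero, add_zero, Finset.mul_sum, ← Finset.sum_add_distrib] at hcomb
    refine Eq.trans ?_ hcomb
    refine Finset.sum_congr rfl fun j _ => ?_
    rw [mul_assoc ((-1 : R[X]) ^ j), ← mul_assoc ((-1 : R[X]) ^ p), ← pow_add]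
    split_ifs with hj
    · rw [hj.neg_one_pow]; ring
    · rw [(Nat.not_even_iff_odd.mp hj).neg_one_pow]; ring
  have hcoeff := congrArg (fun q : R[X] => q.coeff n) hsum
  simp only [finsetSum_coeff, coeff_zero] at hcoeff
  refine Eq.trans (Finset.sum_congr rfl fun j _ => ?_) hcoeff
  split_ifs with hj hn
  · simp [two_mul, coeff_mul_X_pow', hn]
  · simp [two_mul, coeff_mul_X_pow', hn]
  · simp

lemma coeff_eq_zero_of_lt_two
    (hinj : Function.Injective (fun r : R => 2 * r)) {N m : ℕ} {d : ℕ → R[X]}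
    (hsupp : ∀ i, m < i → d i = 0)
    (hpos : ∑ i ∈ Finset.range (m + 1), d i * X ^ (i * N) = 0)
    (hneg : ∑ i ∈ Finset.range (m + 1), (-1 : R[X]) ^ i * d i * X ^ (i * N) = 0)
    {i t : ℕ} (hi : i < 2) (ht : t < 2 * N) :
    (d i).coeff t = 0 := by
  have key := sum_parity_coeff_eq_zero hpos hneg i (t + i * N)
  rw [Finset.sum_eq_single i] at key
  · have e : Even (i + i) := ⟨i, rfl⟩
    simp only [e, if_true, Nat.le_add_left, Nat.add_sub_cancel] at key
    apply hinj
    simpa using key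
  · intro j _ hj
    split_ifs with he hle
    · have : i + 2 ≤ j := by
        obtain ⟨k, hk⟩ := he; omega
      have := Nat.mul_le_mul_right N this
      rw [add_mul] at *; omega
    · simp
    · rfl
  · intro hmem
    rw [hsupp _ (by simpa using hmem)]; simp

lemma coeff_add_two_add_coeff_eq_zero
    (hinj : Function.Injective (fun r : R => 2 * r)) {N m : ℕ} {d : ℕ → R[X]}
    (hsupp : ∀ i, m < i → d i = 0)
    (hpos : ∑ i ∈ Finset.range (m + 1), d i * X ^ (i * N) = 0)
    (hneg : ∑ i ∈ Finset.range (m + 1), (-1 : R[X]) ^ i * d i * X ^ (i * N) = 0)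
    (hdeg : ∀ i t, 4 * N ≤ t → (d i).coeff t = 0)
    (i : ℕ) {t : ℕ} (ht : t < 2 * N) :
    (d (i + 2)).coeff t + (d i).coeff (t + 2 * N) = 0 := by
  have key := sum_parity_coeff_eq_zero hpos hneg i (t + (i + 2) * N)
  rw [Finset.sum_eq_add (i + 2) i (by omega)] at key
  · have h1 : t + (i + 2) * N - i * N = t + 2 * N := by
      rw [add_mul]; omega
    have h2 : i * N ≤ t + (i + 2) * N := by rw [add_mul]; omega
    have e1 : Even (i + (i + 2)) := ⟨i + 1, by ring⟩
    have e2 : Even (i + i) := ⟨i, rfl⟩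
    simp only [e1, e2, h1, h2, if_true, Nat.le_add_left, Nat.add_sub_cancel] at key
    apply hinj
    simpa [mul_add] using key
  · rintro j - ⟨hj1, hj2⟩
    split_ifs with he hle
    · rcases lt_or_ge j i with hlt | hge
      · have : j + 2 ≤ i := by
          obtain ⟨k, hk⟩ := he; omega
        have := Nat.mul_le_mul_right N this
        rw [hdeg _ _ (by rw [add_mul] at *; omega), mul_zero]
      · have : i + 4 ≤ j := by
          obtain ⟨k, hk⟩ := he; omega
        have := Nat.mul_le_mul_right N this
        rw [add_mul] at *; omega
    · simp
    · rfl
  · intro hmem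
    rw [hsupp _ (by simpa using hmem)]; simp
  · intro hmem
    rw [hsupp _ (by simpa using hmem)]; simp

end TwoPoint

/-- The kernel of the four-point Kronecker substitution is trivial. -/
lemma eq_zero_of_four_point {R : Type*} [CommRing R]
    (hinj : Function.Injective (fun r : R => 2 * r)) {N m : ℕ} {d : ℕ → R[X]}
    (hsupp : ∀ i, m < i → d i = 0) (hdeg : ∀ i t, 4 * N ≤ t → (d i).coeff t = 0)
    (hpos : ∑ i ∈ Finset.range (m + 1), d i * X ^ (i * N) = 0)
    (hneg : ∑ i ∈ Finset.range (m + 1), (-1 : R[X]) ^ i * d i * X ^ (i * N) = 0)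
    (hrpos : ∑ i ∈ Finset.range (m + 1), d (m - i) * X ^ (i * N) = 0)
    (hrneg : ∑ i ∈ Finset.range (m + 1), (-1 : R[X]) ^ i * d (m - i) * X ^ (i * N) = 0)
    (i : ℕ) : d i = 0 := by
  set e : ℕ → R[X] := fun i => if i ≤ m then d (m - i) else 0 with he
  have he_of_le : ∀ i ∈ Finset.range (m + 1), d (m - i) = e i := fun i hi => by
    simp [he, Nat.lt_succ_iff.mp (Finset.mem_range.mp hi)]
  have hesupp : ∀ i, m < i → e i = 0 := fun i hi => by simp [he, hi]
  have hedeg : ∀ i t, 4 * N ≤ t → (e i).coeff t = 0 := fun i t ht => by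
    simp only [he]
    split_ifs
    · exact hdeg _ _ ht
    · simp
  rw [Finset.sum_congr rfl fun i hi => by rw [he_of_le i hi]] at hrpos hrneg
  have hstep : ∀ i t, t < 2 * N → (d (i + 2)).coeff t + (d i).coeff (t + 2 * N) = 0 :=
    fun i t ht => coeff_add_two_add_coeff_eq_zero hinj hsupp hpos hneg hdeg i ht
  have hstart : ∀ i t, i < 2 → t < 2 * N → (d i).coeff t = 0 :=
    fun i t hi ht => coeff_eq_zero_of_lt_two hinj hsupp hpos hneg hi ht
  have hrstep : ∀ i t, t < 2 * N → (d i).coeff t + (d (i + 2)).coeff (t + 2 * N) = 0 := by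
    intro i t ht
    rcases Nat.lt_or_ge m i with hi | hi
    · simp [hsupp i hi, hsupp (i + 2) (by omega)]
    rcases Nat.lt_or_ge m (i + 2) with hi2 | hi2
    · have := coeff_eq_zero_of_lt_two hinj hesupp hrpos hrneg
        (i := m - i) (by omega) ht
      simpa [he, hsupp (i + 2) hi2, Nat.sub_sub_self hi] using this
    · have := coeff_add_two_add_coeff_eq_zero hinj hesupp hrpos hrneg hedeg (m - (i + 2)) ht
      have h1 : m - (i + 2) + 2 = m - i := by omega
      simpa [he, h1, Nat.sub_sub_self hi, Nat.sub_sub_self hi2] using this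
  have hrstart : ∀ i t, i < 2 → t < 2 * N → (d i).coeff (t + 2 * N) = 0 := by
    intro i t hi ht
    rcases Nat.lt_or_ge m i with him | him
    · simp [hsupp i him]
    have := coeff_add_two_add_coeff_eq_zero hinj hesupp hrpos hrneg hedeg (m - i) ht
    simpa [he, hesupp (m - i + 2) (by omega), show ¬ m - i + 2 ≤ m by omega,
      Nat.sub_sub_self him] using this
  have hhigh : ∀ i t, t < 2 * N → (d i).coeff (t + 2 * N) = 0 := by
    intro i
    induction i using Nat.strong_induction_on with
    | _ i ih =>
      intro t ht
      rcases Nat.lt_or_ge i 2 with hi | hi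
      · exact hrstart i t hi ht
      obtain ⟨k, rfl⟩ := Nat.exists_eq_add_of_le' hi
      have hk := hrstep k t ht
      have hlow : (d k).coeff t = 0 := by
        rcases Nat.lt_or_ge k 2 with hk2 | hk2
        · exact hstart k t hk2 ht
        obtain ⟨l, rfl⟩ := Nat.exists_eq_add_of_le' hk2
        simpa [ih l (by omega) t ht] using hstep l t ht
      simpa [hlow] using hk
  ext t
  rw [coeff_zero]
  rcases Nat.lt_or_ge t (2 * N) with ht | ht
  · simpa [hhigh (i + 2) t ht] using hrstep i t ht
  rcases Nat.lt_or_ge t (4 * N) with ht4 | ht4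
  · simpa [Nat.sub_add_cancel ht] using hhigh i (t - 2 * N) (by omega)
  · exact hdeg i t ht4

/-- Correctness of the four-point Kronecker substitution. -/
theorem kronecker_four_point_injective {R : Type*} [CommRing R]
    (hinj : Function.Injective (fun r : R => 2 * r)) (N : ℕ) (hN : 0 < N) (m : ℕ)
    (h h' : Polynomial (Polynomial R))
    (hdegY : h.degree ≤ (m : ℕ)) (hdegY' : h'.degree ≤ (m : ℕ))
    (hdeg : ∀ i, (h.coeff i).degree < ((4 * N : ℕ) : ℕ))
    (hdeg' : ∀ i, (h'.coeff i).degree < ((4 * N : ℕ) : ℕ))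
    (heq1 : ∑ i ∈ Finset.range (m + 1), h.coeff i * Polynomial.X ^ (i * N)
          = ∑ i ∈ Finset.range (m + 1), h'.coeff i * Polynomial.X ^ (i * N))
    (heq2 : ∑ i ∈ Finset.range (m + 1), (-1 : Polynomial R) ^ i * h.coeff i * Polynomial.X ^ (i * N)
          = ∑ i ∈ Finset.range (m + 1), (-1 : Polynomial R) ^ i * h'.coeff i * Polynomial.X ^ (i * N))
    (heq3 : ∑ i ∈ Finset.range (m + 1), h.coeff (m - i) * Polynomial.X ^ (i * N)
          = ∑ i ∈ Finset.range (m + 1), h'.coeff (m - i) * Polynomial.X ^ (i * N))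
    (heq4 : ∑ i ∈ Finset.range (m + 1), (-1 : Polynomial R) ^ i * h.coeff (m - i) * Polynomial.X ^ (i * N)
          = ∑ i ∈ Finset.range (m + 1), (-1 : Polynomial R) ^ i * h'.coeff (m - i) * Polynomial.X ^ (i * N)) :
    h = h' := by
  have hzero := eq_zero_of_four_point hinj (N := N) (m := m) (d := fun i => h.coeff i - h'.coeff i)
    (fun i hi => by
      have hi' : ((m : ℕ) : WithBot ℕ) < i := by exact_mod_cast hi
      simp [coeff_eq_zero_of_degree_lt (hdegY.trans_lt hi'),
        coeff_eq_zero_of_degree_lt (hdegY'.trans_lt hi')])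
    (fun i t ht => by
      have ht' : ((4 * N : ℕ) : WithBot ℕ) ≤ t := by exact_mod_cast ht
      simp [coeff_eq_zero_of_degree_lt ((hdeg i).trans_le ht'),
        coeff_eq_zero_of_degree_lt ((hdeg' i).trans_le ht')])
    (by simpa [sub_mul, sub_eq_zero] using heq1)
    (by simpa [mul_sub, sub_mul, sub_eq_zero] using heq2)
    (by simpa [sub_mul, sub_eq_zero] using heq3)
    (by simpa [mul_sub, sub_mul, sub_eq_zero] using heq4)
  ext1 i
  exact sub_eq_zero.mp (hzero i)
end

section
/- Let S be a commutative ring in which the map s ↦ 2s is injective, and suppose there exists ι ∈ S with ι² = −1. Let M be a positive integer. If h, h' ∈ (S[X])[Y] have all their coefficients h_i, h'_i ∈ S[X] of degree strictly less than 4M, and if h(X, ζX^M) = h'(X, ζX^M) in S[X] for each ζ ∈ {1, −1, ι, −ι}, then h = h'. That is, such a bivariate polynomial is uniquely determined by its evaluations at Y = X^M, −X^M, ιX^M and −ιX^M. -/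
open Polynomial

/-- If all coefficients of `p` have degree less than `4 * M` and `p` vanishes at `Y = ζ X ^ M` for
all `ζ ∈ {1, -1, ι, -ι}`, where `ι ^ 2 = -1`, then its constant coefficient vanishes. -/
theorem coeff_zero_eq_zero_of_eval_eq_zero {S : Type*} [CommRing S]
    (hinj : Function.Injective (fun s : S => 2 * s)) {ι : S} (hι : ι ^ 2 = -1) {M : ℕ}
    {p : S[X][X]} (hdeg : ∀ i, (p.coeff i).degree < ((4 * M : ℕ) : ℕ))
    (heval : ∀ ζ ∈ ({1, -1, ι, -ι} : Set S), p.eval (C ζ * X ^ M) = 0) :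
    p.coeff 0 = 0 := by
  have hdecomp (y : S[X]) : p.eval y = p.coeff 0 + p.coeff 1 * y + p.coeff 2 * y ^ 2
      + p.coeff 3 * y ^ 3 + y ^ 4 * p.divX.divX.divX.divX.eval y := by
    have hstep (q : S[X][X]) : q.eval y = q.divX.eval y * y + q.coeff 0 := by
      conv_lhs => rw [← divX_mul_X_add q]
      simp
    rw [hstep p, hstep p.divX, hstep p.divX.divX, hstep p.divX.divX.divX]
    simp only [coeff_divX]
    ring
  have hC : (C ι : S[X]) ^ 2 = -1 := by rw [← C_pow, hι, C_neg, C_1]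
  have h₁ := heval 1 (by simp)
  have h₂ := heval (-1) (by simp)
  have h₃ := heval ι (by simp)
  have h₄ := heval (-ι) (by simp)
  rw [hdecomp] at h₁ h₂ h₃ h₄
  simp only [C_neg, C_1] at h₁ h₂ h₃ h₄
  have hdvd : X ^ (4 * M) ∣ 2 * (2 * p.coeff 0) := by
    set q := p.divX.divX.divX.divX
    refine ⟨-(q.eval (1 * X ^ M) + q.eval (-1 * X ^ M) + q.eval (C ι * X ^ M)
      + q.eval (-C ι * X ^ M)), ?_⟩
    rw [mul_comm 4 M, pow_mul]
    linear_combination h₁ + h₂ + h₃ + h₄ - (2 * p.coeff 2 * (X ^ M) ^ 2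
      + (C ι ^ 2 - 1) * (X ^ M) ^ 4 * (q.eval (C ι * X ^ M) + q.eval (-C ι * X ^ M))) * hC
  ext n
  rcases lt_or_ge n (4 * M) with hn | hn
  · have hcoeff := X_pow_dvd_iff.mp hdvd n hn
    rw [coeff_ofNat_mul, coeff_ofNat_mul] at hcoeff
    have htwo {s : S} (hs : 2 * s = 0) : s = 0 := hinj (by simpa using hs)
    exact htwo (htwo hcoeff)
  · exact coeff_eq_zero_of_degree_lt ((hdeg 0).trans_le (by exact_mod_cast hn))

/-- If all coefficients of `p` have degree less than `4 * M` and `p` vanishes at `Y = ζ X ^ M` for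
all `ζ ∈ {1, -1, ι, -ι}`, where `ι ^ 2 = -1`, then `p = 0`. -/
theorem eq_zero_of_eval_eq_zero {S : Type*} [CommRing S]
    (hinj : Function.Injective (fun s : S => 2 * s)) {ι : S} (hι : ι ^ 2 = -1) {M : ℕ}
    {p : S[X][X]} (hdeg : ∀ i, (p.coeff i).degree < ((4 * M : ℕ) : ℕ))
    (heval : ∀ ζ ∈ ({1, -1, ι, -ι} : Set S), p.eval (C ζ * X ^ M) = 0) :
    p = 0 := by
  refine Polynomial.ext fun i => ?_
  rw [coeff_zero]
  induction i generalizing p with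
  | zero => exact coeff_zero_eq_zero_of_eval_eq_zero hinj hι hdeg heval
  | succ i ih =>
    rw [← coeff_divX]
    refine ih (fun j => by simpa only [coeff_divX] using hdeg (j + 1)) fun ζ hζ => ?_
    have hunit : ζ ^ 4 = 1 := by
      have hι4 : ι ^ 4 = 1 := by linear_combination (ι ^ 2 - 1) * hι
      rcases hζ with rfl | rfl | rfl | rfl
      · ring
      · ring
      · exact hι4
      · rw [← hι4]; ring
    have hmul : p.divX.eval (C ζ * X ^ M) * C ζ * X ^ M = 0 := by
      have hp := heval ζ hζ
      rw [← divX_mul_X_add p, coeff_zero_eq_zero_of_eval_eq_zero hinj hι hdeg heval] at hp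
      simpa [mul_assoc] using hp
    have hmul' : p.divX.eval (C ζ * X ^ M) * C ζ = 0 :=
      (monic_X_pow M).mul_left_eq_zero_iff.mp hmul
    have hC : (C ζ : S[X]) ^ 4 = 1 := by rw [← C_pow, hunit, C_1]
    linear_combination C ζ ^ 3 * hmul' - p.divX.eval (C ζ * X ^ M) * hC

/-- Reconstruction claim underlying the complex-evaluation-points variant of
Kronecker substitution. -/
theorem kronecker_complex_injective {S : Type*} [CommRing S]
    (hinj : Function.Injective (fun s : S => 2 * s))
    (ι : S) (hι : ι ^ 2 = -1) (M : ℕ) (hM : 0 < M)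
    (h h' : Polynomial (Polynomial S))
    (hdeg : ∀ i, (h.coeff i).degree < ((4 * M : ℕ) : ℕ))
    (hdeg' : ∀ i, (h'.coeff i).degree < ((4 * M : ℕ) : ℕ))
    (heq : ∀ ζ ∈ ({1, -1, ι, -ι} : Set S),
        Polynomial.eval (Polynomial.C ζ * Polynomial.X ^ M) h
          = Polynomial.eval (Polynomial.C ζ * Polynomial.X ^ M) h') :
    h = h' := by
  refine sub_eq_zero.mp (eq_zero_of_eval_eq_zero (M := M) hinj hι (fun i => ?_) fun ζ hζ => ?_)
  · rw [coeff_sub]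
    exact (degree_sub_le _ _).trans_lt (max_lt (hdeg i) (hdeg' i))
  · rw [eval_sub, heq ζ hζ, sub_self]
end

section
/- Let L and b be positive integers, let e = ⌈log₂ L⌉ and N = b + ⌈e/2⌉. Then L·(2^b − 1)² ≤ 2^e·(2^(2b) − 2^(b+1) + 1) and 2^e·(2^(2b) − 2^(b+1) + 1) < 2^(2N) − 2^N. In particular, L·(2^b − 1)² < 2^N·(2^N − 1). -/
/-- The inequality chain controlling carries in the reciprocal integer
Kronecker substitution. Here `e = ⌈log₂ L⌉` and `N = b + ⌈e/2⌉`. -/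
theorem kronecker_carry_bound (L b : ℕ) (hL : 0 < L) (hb : 0 < b)
    (e N : ℕ) (he : e = Nat.clog 2 L) (hN : N = b + (e + 1) / 2) :
    (L : ℤ) * (2 ^ b - 1) ^ 2 ≤ 2 ^ e * (2 ^ (2 * b) - 2 ^ (b + 1) + 1) ∧
    (2 : ℤ) ^ e * (2 ^ (2 * b) - 2 ^ (b + 1) + 1) < 2 ^ (2 * N) - 2 ^ N ∧
    (L : ℤ) * (2 ^ b - 1) ^ 2 < 2 ^ N * (2 ^ N - 1) := by
  have hLe : (L : ℤ) ≤ 2 ^ e := by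
    rw [he]
    exact_mod_cast Nat.le_pow_clog one_lt_two L
  have hsq : (2 : ℤ) ^ (2 * b) - 2 ^ (b + 1) + 1 = (2 ^ b - 1) ^ 2 := by ring
  have hN2 : (2 : ℤ) ^ (2 * N) = (2 ^ N) ^ 2 := by ring
  have heC : (2 : ℤ) ^ e ≤ (2 ^ ((e + 1) / 2)) ^ 2 := by
    rw [← pow_mul]
    exact pow_le_pow_right₀ one_le_two (by omega)
  have hNBC : (2 : ℤ) ^ N = 2 ^ b * 2 ^ ((e + 1) / 2) := by rw [hN, pow_add]
  have hB : (2 : ℤ) ≤ 2 ^ b := le_self_pow₀ one_le_two hb.ne'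
  have hC : (1 : ℤ) ≤ 2 ^ ((e + 1) / 2) := one_le_pow₀ one_le_two
  rw [hsq, hN2, hNBC]
  generalize (2 : ℤ) ^ b = B at *
  generalize (2 : ℤ) ^ ((e + 1) / 2) = C at *
  have lower : (L : ℤ) * (B - 1) ^ 2 ≤ 2 ^ e * (B - 1) ^ 2 :=
    mul_le_mul_of_nonneg_right hLe (sq_nonneg _)
  have upper : (2 : ℤ) ^ e * (B - 1) ^ 2 < (B * C) ^ 2 - B * C := by
    have hmono : (2 : ℤ) ^ e * (B - 1) ^ 2 ≤ C ^ 2 * (B - 1) ^ 2 :=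
      mul_le_mul_of_nonneg_right heC (sq_nonneg _)
    have hgap : 0 < C * (C * (2 * B - 1) - B) :=
      mul_pos (by linarith) (by nlinarith)
    linarith
  exact ⟨lower, upper, by linarith⟩
end

section
/- Let N be a positive integer and D ≥ 0 an integer. Let h, h' ∈ ℤ[X] each have degree at most D, with every coefficient lying in the interval [0, 2^N(2^N − 1) − 1]. If h(2^N) = h'(2^N) and Σ_{i=0}^{D} h_{D−i}·2^(iN) = Σ_{i=0}^{D} h'_{D−i}·2^(iN), then h = h'. That is, such a polynomial is uniquely determined by its evaluation at 2^N together with its normalized reciprocal evaluation 2^(DN)·h(2^(−N)). -/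
open Polynomial

/-- A sum of powers of `B` in descending order whose coefficients are at most `B * (B - 1)` in
absolute value is at most `B ^ (n + 1) - B` in absolute value. -/
theorem abs_sum_mul_pow_sub_le {B : ℤ} (hB : 0 ≤ B) (n : ℕ) (d : ℕ → ℤ)
    (hd : ∀ i, |d i| ≤ B * (B - 1)) :
    |∑ i ∈ Finset.range n, d i * B ^ (n - 1 - i)| ≤ B ^ (n + 1) - B := by
  induction n generalizing d with
  | zero => simp
  | succ n ih =>
    have hexp (i : ℕ) : n + 1 - 1 - (i + 1) = n - 1 - i := by omega
    rw [Finset.sum_range_succ']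
    simp only [hexp]
    rw [Nat.add_sub_cancel, Nat.sub_zero]
    have htail := ih (fun i => d (i + 1)) fun i => hd _
    have hhead : |d 0 * B ^ n| ≤ B * (B - 1) * B ^ n := by
      rw [abs_mul, abs_of_nonneg (pow_nonneg hB n)]
      exact mul_le_mul_of_nonneg_right (hd 0) (pow_nonneg hB n)
    calc
      _ ≤ _ := abs_add_le _ _
      _ ≤ (B ^ (n + 1) - B) + B * (B - 1) * B ^ n := add_le_add htail hhead
      _ = B ^ (n + 1 + 1) - B := by ring

/-- Integers of absolute value at most `B * (B - 1)` vanish if both their ascending and their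
descending expansions in base `B` do. -/
theorem eq_zero_of_sum_mul_pow_eq_zero {B : ℤ} (hB : 0 < B) (n : ℕ) (d : ℕ → ℤ)
    (hd : ∀ i, |d i| ≤ B * (B - 1))
    (hasc : ∑ i ∈ Finset.range n, d i * B ^ i = 0)
    (hdesc : ∑ i ∈ Finset.range n, d i * B ^ (n - 1 - i) = 0) :
    ∀ i < n, d i = 0 := by
  induction n generalizing d with
  | zero => simp
  | succ n ih =>
    have hexp (i : ℕ) : n + 1 - 1 - (i + 1) = n - 1 - i := by omega
    rw [Finset.sum_range_succ'] at hasc hdesc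
    simp only [hexp] at hdesc
    rw [Nat.add_sub_cancel, Nat.sub_zero] at hdesc
    simp only [pow_succ, ← mul_assoc, ← Finset.sum_mul, pow_zero, mul_one] at hasc
    have hdvd : B ∣ d 0 := ⟨-∑ i ∈ Finset.range n, d (i + 1) * B ^ i, by linarith⟩
    have hlt : |d 0| < B := by
      have htail := abs_sum_mul_pow_sub_le hB.le n (fun i => d (i + 1)) fun i => hd _
      rw [eq_neg_of_add_eq_zero_left hdesc, abs_neg, abs_mul,
        abs_of_pos (pow_pos hB n), pow_succ'] at htail
      exact lt_of_mul_lt_mul_right (by linarith) (pow_pos hB n).le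
    have hzero : d 0 = 0 := Int.eq_zero_of_abs_lt_dvd hdvd hlt
    rw [hzero, add_zero] at hasc
    rw [hzero, zero_mul, add_zero] at hdesc
    have htail := ih (fun i => d (i + 1)) (fun i => hd _)
      ((mul_eq_zero.mp hasc).resolve_right hB.ne') hdesc
    rintro (_ | i) hi
    · exact hzero
    · exact htail i (by omega)

/-- Correctness of the carry-handling reconstruction of the reciprocal integer
Kronecker substitution. -/
theorem kronecker_integer_reciprocal_injective (N : ℕ) (hN : 0 < N) (D : ℕ)
    (h h' : Polynomial ℤ) (hdeg : h.degree ≤ (D : ℕ)) (hdeg' : h'.degree ≤ (D : ℕ))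
    (hc : ∀ i, 0 ≤ h.coeff i ∧ h.coeff i ≤ 2 ^ N * (2 ^ N - 1) - 1)
    (hc' : ∀ i, 0 ≤ h'.coeff i ∧ h'.coeff i ≤ 2 ^ N * (2 ^ N - 1) - 1)
    (heq1 : h.eval (2 ^ N) = h'.eval (2 ^ N))
    (heq2 : ∑ i ∈ Finset.range (D + 1), h.coeff (D - i) * 2 ^ (i * N)
          = ∑ i ∈ Finset.range (D + 1), h'.coeff (D - i) * 2 ^ (i * N)) :
    h = h' := by
  have hnat : h.natDegree < D + 1 := Nat.lt_succ_of_le (natDegree_le_of_degree_le hdeg)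
  have hnat' : h'.natDegree < D + 1 := Nat.lt_succ_of_le (natDegree_le_of_degree_le hdeg')
  have hzero := eq_zero_of_sum_mul_pow_eq_zero (B := 2 ^ N) (by positivity) (D + 1)
    (fun i => h.coeff i - h'.coeff i)
    (fun i => abs_le.mpr ⟨by linarith [hc i, hc' i], by linarith [hc i, hc' i]⟩)
    (by
      rw [eval_eq_sum_range' hnat, eval_eq_sum_range' hnat'] at heq1
      simp only [sub_mul, Finset.sum_sub_distrib, heq1, sub_self])
    (by
      rw [← Finset.sum_range_reflect, ← sub_eq_zero.mpr heq2, ← Finset.sum_sub_distrib]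
      refine Finset.sum_congr rfl fun i hi => ?_
      have hle : i ≤ D := Nat.lt_succ_iff.mp (Finset.mem_range.mp hi)
      rw [Nat.add_sub_cancel, Nat.sub_sub_self hle, ← pow_mul, mul_comm N, sub_mul])
  ext i
  rcases lt_or_ge i (D + 1) with hi | hi
  · exact sub_eq_zero.mp (hzero i hi)
  · rw [coeff_eq_zero_of_natDegree_lt (hnat.trans_le hi),
      coeff_eq_zero_of_natDegree_lt (hnat'.trans_le hi)]
end

section
/- Let N be a positive integer, and let h, h' ∈ ℤ[X] have all coefficients in the interval [0, 2^(2N) − 1]. If h(2^N) = h'(2^N) and h(−2^N) = h'(−2^N), then h = h'. That is, a polynomial with nonnegative coefficients of bit-length at most 2N is uniquely determined by its evaluations at 2^N and −2^N. -/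
open Polynomial

/-- A nonzero integer polynomial that vanishes at both `b` and `-b`, with `b ≠ 0`,
has a trailing coefficient divisible by `b ^ 2`. -/
theorem sq_dvd_trailingCoeff_of_eval_eq_zero {b : ℤ} (hb : b ≠ 0) {d : ℤ[X]}
    (hpos : d.eval b = 0) (hneg : d.eval (-b) = 0) : b ^ 2 ∣ d.trailingCoeff := by
  obtain ⟨q, rfl⟩ := dvd_iff_isRoot.mpr hpos
  have hq : q.eval (-b) = 0 := by
    simp only [eval_mul, eval_sub, eval_X, eval_C, mul_eq_zero] at hneg
    exact hneg.resolve_left (by lia)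
  obtain ⟨r, rfl⟩ := dvd_iff_isRoot.mpr hq
  have trailing (a : ℤ) (ha : a ≠ 0) : (X - C a).trailingCoeff = -a := by
    rw [trailingCoeff, natTrailingDegree_eq_zero_of_constantCoeff_ne_zero] <;> simp [ha]
  rw [trailingCoeff_mul, trailingCoeff_mul, trailing b hb, trailing (-b) (neg_ne_zero.mpr hb)]
  exact ⟨-r.trailingCoeff, by ring⟩

/-- Correctness of the negated integer Kronecker substitution. -/
theorem kronecker_integer_negated_injective (N : ℕ) (hN : 0 < N)
    (h h' : Polynomial ℤ)
    (hc : ∀ i, 0 ≤ h.coeff i ∧ h.coeff i ≤ 2 ^ (2 * N) - 1)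
    (hc' : ∀ i, 0 ≤ h'.coeff i ∧ h'.coeff i ≤ 2 ^ (2 * N) - 1)
    (heq1 : h.eval (2 ^ N) = h'.eval (2 ^ N))
    (heq2 : h.eval (-(2 ^ N)) = h'.eval (-(2 ^ N))) :
    h = h' := by
  have hdvd : ((2 : ℤ) ^ N) ^ 2 ∣ (h - h').trailingCoeff :=
    sq_dvd_trailingCoeff_of_eval_eq_zero (by positivity)
      (by rw [eval_sub, heq1, sub_self]) (by rw [eval_sub, heq2, sub_self])
  rw [← pow_mul, mul_comm N 2] at hdvd
  rw [← sub_eq_zero, ← trailingCoeff_eq_zero]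
  refine Int.eq_zero_of_abs_lt_dvd hdvd ?_
  rw [trailingCoeff, coeff_sub, abs_lt]
  have hi := hc (h - h').natTrailingDegree
  have hi' := hc' (h - h').natTrailingDegree
  constructor <;> linarith
end

section
/- Let N be a positive integer and D ≥ 0 an integer. Let h, h' ∈ ℤ[X] each have degree at most D, with every coefficient lying in the interval [0, 2^(2N)(2^(2N) − 1) − 1]. Suppose the following four integer equalities hold: Σ_{i=0}^{D} h_i·2^(iN) = Σ_{i=0}^{D} h'_i·2^(iN); Σ_{i=0}^{D} (−1)^i h_i·2^(iN) = Σ_{i=0}^{D} (−1)^i h'_i·2^(iN); Σ_{i=0}^{D} h_{D−i}·2^(iN) = Σ_{i=0}^{D} h'_{D−i}·2^(iN); and Σ_{i=0}^{D} (−1)^i h_{D−i}·2^(iN) = Σ_{i=0}^{D} (−1)^i h'_{D−i}·2^(iN). Then h = h'. That is, such a polynomial is uniquely determined by its evaluations at the four points 2^N, −2^N, 2^(−N), −2^(−N) (the reciprocal evaluations normalized by 2^(DN)). -/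
open Polynomial

theorem Polynomial.X_sq_sub_C_sq_dvd {p : ℤ[X]} {x : ℤ} (hx : x ≠ 0)
    (hp : p.eval x = 0) (hn : p.eval (-x) = 0) : X ^ 2 - C (x ^ 2) ∣ p := by
  obtain ⟨r, rfl⟩ := dvd_iff_isRoot.mpr hp
  have hr : r.eval (-x) = 0 := by
    rw [eval_mul, mul_eq_zero] at hn
    refine hn.resolve_left ?_
    simp only [eval_sub, eval_X, eval_C]
    omega
  obtain ⟨s, rfl⟩ := dvd_iff_isRoot.mpr hr
  exact ⟨s, by simp only [map_neg, map_pow]; ring⟩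

theorem Polynomial.natDegree_X_sq_sub_C_mul {r : ℤ[X]} (hr : r ≠ 0) (b : ℤ) :
    ((X ^ 2 - C b) * r).natDegree = 2 + r.natDegree := by
  rw [(monic_X_pow_sub_C b two_ne_zero).natDegree_mul' hr, natDegree_X_pow_sub_C]

theorem Polynomial.reflect_X_sq_sub_C_mul {r : ℤ[X]} {k : ℕ} (hr : r.natDegree ≤ k) (b : ℤ) :
    reflect (2 + k) ((X ^ 2 - C b) * r) = (1 - C b * X ^ 2) * reflect k r := by
  rw [reflect_mul _ _ (natDegree_X_pow_sub_C (n := 2) (r := b)).le hr, reflect_sub, reflect_C,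
    reflect_monomial, revAt_le le_rfl, Nat.sub_self, pow_zero]

theorem Polynomial.eval_reflect_eq_sum_range {p : ℤ[X]} {n : ℕ} (hp : p.natDegree ≤ n) (x : ℤ) :
    (reflect n p).eval x = ∑ i ∈ Finset.range (n + 1), p.coeff (n - i) * x ^ i := by
  have hdeg : (reflect n p).natDegree < n + 1 :=
    Nat.lt_succ_of_le ((natDegree_reflect_le).trans (max_le le_rfl hp))
  rw [eval_eq_sum_range' hdeg]
  refine Finset.sum_congr rfl fun i hi ↦ ?_
  rw [coeff_reflect, revAt_le (Finset.mem_range_succ_iff.mp hi)]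

theorem Polynomial.exists_eq_mul_of_eval_reflect_eq_zero {p : ℤ[X]} {x : ℤ} {n : ℕ} (hx : 1 < x)
    (hn : p.natDegree ≤ n) (h₁ : p.eval x = 0) (h₂ : p.eval (-x) = 0)
    (h₃ : (reflect n p).eval x = 0) (h₄ : (reflect n p).eval (-x) = 0) :
    ∃ q, p = (X ^ 2 - C (x ^ 2)) * ((1 - C (x ^ 2) * X ^ 2) * q) := by
  obtain ⟨r, rfl⟩ := X_sq_sub_C_sq_dvd (by omega) h₁ h₂
  rcases eq_or_ne r 0 with rfl | hr
  · exact ⟨0, by simp⟩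
  rw [natDegree_X_sq_sub_C_mul hr] at hn
  obtain ⟨k, rfl⟩ := Nat.exists_eq_add_of_le (Nat.le_of_add_right_le hn)
  have hrk : r.natDegree ≤ k := by omega
  have hx4 : 1 - x ^ 2 * x ^ 2 ≠ 0 := by nlinarith [mul_pos (sub_pos.mpr hx) (sub_pos.mpr hx)]
  rw [reflect_X_sq_sub_C_mul hrk, eval_mul, mul_eq_zero] at h₃ h₄
  obtain ⟨s, hs⟩ := X_sq_sub_C_sq_dvd (by omega)
    (h₃.resolve_left (by simpa using hx4)) (h₄.resolve_left (by simpa using hx4))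
  have hs0 : s ≠ 0 := by
    rintro rfl
    rw [mul_zero, reflect_eq_zero_iff] at hs
    exact hr hs
  have hdeg : (reflect k r).natDegree ≤ k := natDegree_reflect_le.trans (max_le le_rfl hrk)
  rw [hs, natDegree_X_sq_sub_C_mul hs0] at hdeg
  obtain ⟨m, rfl⟩ := Nat.exists_eq_add_of_le (Nat.le_of_add_right_le hdeg)
  refine ⟨reflect m s, ?_⟩
  rw [← reflect_X_sq_sub_C_mul (by omega), ← hs, reflect_reflect]

theorem Polynomial.exists_first_max_abs_coeff {q : ℤ[X]} (hq : q ≠ 0) :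
    ∃ j, q.coeff j ≠ 0 ∧ (∀ i, |q.coeff i| ≤ |q.coeff j|) ∧
      ∀ i < j, |q.coeff i| < |q.coeff j| := by
  classical
  have hmax : ∃ j, ∀ i, |q.coeff i| ≤ |q.coeff j| := by
    obtain ⟨j, -, hj⟩ := Finset.exists_max_image q.support (fun i ↦ |q.coeff i|)
      (support_nonempty.mpr hq)
    refine ⟨j, fun i ↦ ?_⟩
    by_cases hi : i ∈ q.support
    · exact hj i hi
    · simp [notMem_support_iff.mp hi]
  have hspec := Nat.find_spec hmax
  refine ⟨Nat.find hmax, fun h0 ↦ hq ?_, hspec, fun i hi ↦ ?_⟩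
  · ext i
    simpa [h0] using hspec i
  · by_contra! hle
    exact Nat.find_min hmax hi fun k ↦ (hspec k).trans hle

/-- The coefficient of the product two places above the first coefficient of `q` of maximal
absolute value is too large. -/
theorem Polynomial.eq_zero_of_abs_coeff_mul_lt {q : ℤ[X]} {b : ℤ} (hb : 0 < b)
    (hq : ∀ i, |((X ^ 2 - C b) * ((1 - C b * X ^ 2) * q)).coeff i| < b * (b - 1)) : q = 0 := by
  by_contra hq0
  obtain ⟨j, hj0, hmax, hfirst⟩ := exists_first_max_abs_coeff hq0
  have hpos : 1 ≤ |q.coeff j| := Int.one_le_abs hj0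
  have hprod : (X ^ 2 - C b) * ((1 - C b * X ^ 2) * q) =
      C (1 + b ^ 2) * q * X ^ 2 - C b * q - C b * (q * X ^ 2) * X ^ 2 := by
    simp only [map_add, map_one, map_pow]
    ring
  have hlow : |(q * X ^ 2).coeff j| ≤ |q.coeff j| - 1 := by
    rw [coeff_mul_X_pow']
    split_ifs with h2
    · exact Int.le_sub_one_of_lt (hfirst _ (by omega))
    · simpa using hpos
  have hcoeff := hq (j + 2)
  rw [hprod, coeff_sub, coeff_sub, coeff_mul_X_pow, coeff_mul_X_pow, coeff_C_mul, coeff_C_mul,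
    coeff_C_mul] at hcoeff
  have htri : (1 + b ^ 2) * |q.coeff j| ≤ b * (b - 1) - 1 + b * |q.coeff (j + 2)| +
      b * |(q * X ^ 2).coeff j| := by
    rw [← abs_of_pos hb, ← abs_mul, ← abs_mul, abs_of_pos hb,
      ← abs_of_pos (show 0 < 1 + b ^ 2 by positivity), ← abs_mul]
    grind
  nlinarith [mul_le_mul_of_nonneg_left (hmax (j + 2)) hb.le,
    mul_le_mul_of_nonneg_left hlow hb.le, mul_nonneg (sq_nonneg (b - 1)) (sub_nonneg.mpr hpos)]

/-- Correctness of the four-point integer Kronecker substitution. -/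
theorem kronecker_integer_four_point_injective (N : ℕ) (hN : 0 < N) (D : ℕ)
    (h h' : Polynomial ℤ) (hdeg : h.degree ≤ (D : ℕ)) (hdeg' : h'.degree ≤ (D : ℕ))
    (hc : ∀ i, 0 ≤ h.coeff i ∧ h.coeff i ≤ 2 ^ (2 * N) * (2 ^ (2 * N) - 1) - 1)
    (hc' : ∀ i, 0 ≤ h'.coeff i ∧ h'.coeff i ≤ 2 ^ (2 * N) * (2 ^ (2 * N) - 1) - 1)
    (heq1 : ∑ i ∈ Finset.range (D + 1), h.coeff i * 2 ^ (i * N)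
          = ∑ i ∈ Finset.range (D + 1), h'.coeff i * 2 ^ (i * N))
    (heq2 : ∑ i ∈ Finset.range (D + 1), (-1 : ℤ) ^ i * h.coeff i * 2 ^ (i * N)
          = ∑ i ∈ Finset.range (D + 1), (-1 : ℤ) ^ i * h'.coeff i * 2 ^ (i * N))
    (heq3 : ∑ i ∈ Finset.range (D + 1), h.coeff (D - i) * 2 ^ (i * N)
          = ∑ i ∈ Finset.range (D + 1), h'.coeff (D - i) * 2 ^ (i * N))
    (heq4 : ∑ i ∈ Finset.range (D + 1), (-1 : ℤ) ^ i * h.coeff (D - i) * 2 ^ (i * N)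
          = ∑ i ∈ Finset.range (D + 1), (-1 : ℤ) ^ i * h'.coeff (D - i) * 2 ^ (i * N)) :
    h = h' := by
  have hx : (1 : ℤ) < 2 ^ N := one_lt_pow₀ (by norm_num) hN.ne'
  have hb : ((2 : ℤ) ^ N) ^ 2 = 2 ^ (2 * N) := by rw [← pow_mul, mul_comm]
  have hd : (h - h').natDegree ≤ D :=
    natDegree_le_iff_degree_le.mpr ((degree_sub_le _ _).trans (max_le hdeg hdeg'))
  have hpow (i : ℕ) : ((2 : ℤ) ^ N) ^ i = 2 ^ (i * N) := by rw [← pow_mul, mul_comm]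
  have hneg (i : ℕ) : (-(2 : ℤ) ^ N) ^ i = (-1) ^ i * 2 ^ (i * N) := by rw [neg_pow, hpow]
  have hcomm (a : ℤ) (i : ℕ) : a * ((-1) ^ i * 2 ^ (i * N)) = (-1) ^ i * a * 2 ^ (i * N) := by ring
  obtain ⟨q, hq⟩ := exists_eq_mul_of_eval_reflect_eq_zero hx hd
    (by
      rw [eval_eq_sum_range' (Nat.lt_succ_of_le hd)]
      simp only [coeff_sub, sub_mul, Finset.sum_sub_distrib, hpow, heq1, sub_self])
    (by
      rw [eval_eq_sum_range' (Nat.lt_succ_of_le hd)]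
      simp only [coeff_sub, hneg, hcomm, mul_sub, sub_mul, Finset.sum_sub_distrib, heq2, sub_self])
    (by
      rw [eval_reflect_eq_sum_range hd]
      simp only [coeff_sub, sub_mul, Finset.sum_sub_distrib, hpow, heq3, sub_self])
    (by
      rw [eval_reflect_eq_sum_range hd]
      simp only [coeff_sub, hneg, hcomm, mul_sub, sub_mul, Finset.sum_sub_distrib, heq4, sub_self])
  have hq0 : q = 0 := by
    refine eq_zero_of_abs_coeff_mul_lt (b := (2 ^ N) ^ 2) (by positivity) fun i ↦ ?_
    rw [← hq, hb, coeff_sub, abs_lt]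
    have := hc i
    have := hc' i
    constructor <;> linarith
  rw [hq0, mul_zero, mul_zero] at hq
  exact sub_eq_zero.mp hq
end
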